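/- arXiv:2506.08133 — 6 statements merged into one kernel-verified Lean document; each statement's English description precedes it below -/
import Mathlib

section
/- Fix integers N ≥ 1, r ≥ 0, and 0 ≤ i ≤ N. Let d = (d_0, d_1, …, d_N) be any degree sequence with d_0 = 0 and d_N ≤ N + r. Then the rational number β_i(π_d) satisfies binom(N,i) · N^(−r) ≤ β_i(π_d) ≤ binom(N,i) · N^r. -/
/-- The `i`-th total Betti number of the pure diagram `π_d` associated to a degree
sequence `d = (d 0, d 1, …, d N)` of length `N` (with `d 0 = 0`):
`β_i(π_d) = (∏_{j=1}^N d_j) / (∏_{j ≠ i} |d_i − d_j|)`. -/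
noncomputable def pureBetti (N : ℕ) (d : ℕ → ℤ) (i : ℕ) : ℚ :=
  (∏ j ∈ Finset.Icc 1 N, (d j : ℚ)) /
    ∏ j ∈ (Finset.range (N + 1)).erase i, |(d i : ℚ) - (d j : ℚ)|

open Finset

theorem ascFactorial_mul_ascFactorial_le_mul_pow (m n s : ℕ) :
    (s + 1).ascFactorial m * (m + s + 2).ascFactorial n ≤
      m.factorial * (m + 2).ascFactorial n * (m + 1 + n) ^ s := by
  induction s with
  | zero => simp [Nat.one_ascFactorial]
  | succ s ih =>
    have h1 := Nat.succ_ascFactorial (s + 1) m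
    have h2 := Nat.succ_ascFactorial (m + s + 2) n
    have hstep : (s + 1 + m) * (m + s + 2 + n) ≤ (m + 1 + n) * ((s + 1) * (m + s + 2)) := by
      nlinarith [Nat.zero_le (s * m), Nat.zero_le (s * n), Nat.zero_le (s * m * m),
        Nat.zero_le (s * m * n), Nat.zero_le (s * s * n), Nat.zero_le (s * s * m)]
    refine Nat.le_of_mul_le_mul_left (c := (s + 1) * (m + s + 2)) ?_ (by positivity)
    calc (s + 1) * (m + s + 2) *
          ((s + 1 + 1).ascFactorial m * (m + (s + 1) + 2).ascFactorial n)
        = ((s + 1) * (s + 1).succ.ascFactorial m) *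
            ((m + s + 2) * (m + s + 2).succ.ascFactorial n) := by
          rw [show m + (s + 1) + 2 = (m + s + 2).succ by omega]
          simp only [Nat.succ_eq_add_one]; ring
      _ = ((s + 1 + m) * (m + s + 2 + n)) *
            ((s + 1).ascFactorial m * (m + s + 2).ascFactorial n) := by rw [h1, h2]; ring
      _ ≤ ((m + 1 + n) * ((s + 1) * (m + s + 2))) *
            (m.factorial * (m + 2).ascFactorial n * (m + 1 + n) ^ s) := Nat.mul_le_mul hstep ih
      _ = _ := by ring

theorem ascFactorial_mul_ascFactorial_le_factorial_mul_pow (m n u : ℕ) :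
    (u + 1).ascFactorial n * (m + 2).ascFactorial n ≤
      (m + 2 + u).ascFactorial n * n.factorial * (m + 1 + n) ^ u := by
  induction u with
  | zero => simp [Nat.one_ascFactorial, mul_comm]
  | succ u ih =>
    have h1 := Nat.succ_ascFactorial (u + 1) n
    have h2 := Nat.succ_ascFactorial (m + 2 + u) n
    have hstep : (u + 1 + n) * (m + 2 + u) ≤ (m + 1 + n) * (u + 1) * (m + 2 + u + n) :=
      Nat.mul_le_mul (by nlinarith [Nat.zero_le (u * m), Nat.zero_le (u * n)]) (by omega)
    refine Nat.le_of_mul_le_mul_left (c := (u + 1) * (m + 2 + u)) ?_ (by positivity)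
    calc (u + 1) * (m + 2 + u) * ((u + 1 + 1).ascFactorial n * (m + 2).ascFactorial n)
        = ((u + 1) * (u + 1).succ.ascFactorial n) * (m + 2 + u) * (m + 2).ascFactorial n := by
          simp only [Nat.succ_eq_add_one]; ring
      _ = ((u + 1 + n) * (m + 2 + u)) *
            ((u + 1).ascFactorial n * (m + 2).ascFactorial n) := by rw [h1]; ring
      _ ≤ ((m + 1 + n) * (u + 1) * (m + 2 + u + n)) *
            ((m + 2 + u).ascFactorial n * n.factorial * (m + 1 + n) ^ u) :=
          Nat.mul_le_mul hstep ih
      _ = (m + 1 + n) * (u + 1) * ((m + 2 + u + n) * (m + 2 + u).ascFactorial n) *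
            n.factorial * (m + 1 + n) ^ u := by ring
      _ = _ := by
          rw [← h2, show m + 2 + (u + 1) = (m + 2 + u).succ by omega]; ring

theorem ascFactorial_mul_ascFactorial_mul_ascFactorial_le (m n u s : ℕ) :
    (s + 1).ascFactorial m * (u + 1).ascFactorial n * (m + 2).ascFactorial n ≤
      m.factorial * (m + 2 + u + s).ascFactorial n * n.factorial * (m + 1 + n) ^ (u + s) := by
  induction s with
  | zero =>
    have h := Nat.mul_le_mul_left m.factorial
      (ascFactorial_mul_ascFactorial_le_factorial_mul_pow m n u)
    simpa [Nat.one_ascFactorial, mul_assoc] using h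
  | succ s ih =>
    have h1 := Nat.succ_ascFactorial (s + 1) m
    have h2 := Nat.succ_ascFactorial (m + 2 + u + s) n
    have hstep : (s + 1 + m) * (m + 2 + u + s) ≤
        (m + 1 + n) * (s + 1) * (m + 2 + u + s + n) :=
      Nat.mul_le_mul (by nlinarith [Nat.zero_le (s * m), Nat.zero_le (s * n)]) (by omega)
    refine Nat.le_of_mul_le_mul_left (c := (s + 1) * (m + 2 + u + s)) ?_ (by positivity)
    calc (s + 1) * (m + 2 + u + s) *
          ((s + 1 + 1).ascFactorial m * (u + 1).ascFactorial n * (m + 2).ascFactorial n)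
        = ((s + 1) * (s + 1).succ.ascFactorial m) * (m + 2 + u + s) *
            ((u + 1).ascFactorial n * (m + 2).ascFactorial n) := by
          simp only [Nat.succ_eq_add_one]; ring
      _ = ((s + 1 + m) * (m + 2 + u + s)) *
            ((s + 1).ascFactorial m * (u + 1).ascFactorial n * (m + 2).ascFactorial n) := by
          rw [h1]; ring
      _ ≤ ((m + 1 + n) * (s + 1) * (m + 2 + u + s + n)) *
            (m.factorial * (m + 2 + u + s).ascFactorial n * n.factorial *
              (m + 1 + n) ^ (u + s)) := Nat.mul_le_mul hstep ih
      _ = (m + 1 + n) * (s + 1) * m.factorial *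
            ((m + 2 + u + s + n) * (m + 2 + u + s).ascFactorial n) * n.factorial *
              (m + 1 + n) ^ (u + s) := by ring
      _ = _ := by
          rw [← h2, show m + 2 + u + (s + 1) = (m + 2 + u + s).succ by omega]; ring

theorem prod_range_cast_add (a n : ℕ) :
    ∏ t ∈ range n, ((a : ℚ) + t) = (a.ascFactorial n : ℚ) := by
  rw [Nat.ascFactorial_eq_prod_range]; push_cast; rfl

theorem prod_range_cast_add_sub (a n : ℕ) :
    ∏ t ∈ range n, ((a : ℚ) + n - t) = ((a + 1).ascFactorial n : ℚ) := by
  rw [← prod_range_cast_add, ← prod_range_reflect]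
  refine prod_congr rfl fun t ht => ?_
  have ht := mem_range.1 ht
  rw [Nat.sub_sub, Nat.cast_sub (by omega)]
  push_cast; ring

theorem prod_range_erase_succ {M : Type*} [CommMonoid M] (f : ℕ → M) (m n : ℕ) :
    ∏ j ∈ (range (m + 1 + n + 1)).erase (m + 1), f j =
      f 0 * (∏ t ∈ range m, f (t + 1)) * ∏ t ∈ range n, f (m + 2 + t) := by
  have h : (range (m + 1 + n + 1)).erase (m + 1) = range (m + 1) ∪ Ico (m + 2) (m + 2 + n) := by
    ext j; simp only [mem_erase, mem_range, mem_union, mem_Ico]; omega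
  have hd : Disjoint (range (m + 1)) (Ico (m + 2) (m + 2 + n)) := by
    rw [disjoint_left]; intro j; simp only [mem_range, mem_Ico]; omega
  rw [h, prod_union hd, prod_range_succ', prod_Ico_eq_prod_range, Nat.add_sub_cancel_left,
    mul_comm (∏ _ ∈ _, _) (f 0)]

theorem prod_Icc_one_eq {M : Type*} [CommMonoid M] (f : ℕ → M) (m n : ℕ) :
    ∏ j ∈ Icc 1 (m + 1 + n), f j =
      f (m + 1) * (∏ t ∈ range m, f (t + 1)) * ∏ t ∈ range n, f (m + 2 + t) := by
  have h : Icc 1 (m + 1 + n) = Ico 1 (m + 1 + n + 1) := by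
    ext j; simp only [mem_Icc, mem_Ico]; omega
  rw [h, prod_Ico_eq_prod_range, Nat.add_sub_cancel, prod_range_add, prod_range_succ,
    mul_comm (f (m + 1))]
  refine congrArg₂ _ (congrArg₂ _ (prod_congr rfl fun t _ => ?_) ?_)
    (prod_congr rfl fun t _ => ?_) <;> congr 1 <;> omega

theorem degree_add_sub_le {N : ℕ} {d : ℕ → ℤ} (hmono : ∀ j < N, d j < d (j + 1))
    {j k : ℕ} (hjk : j ≤ k) (hk : k ≤ N) : d j + ((k : ℤ) - j) ≤ d k := by
  induction k, hjk using Nat.le_induction with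
  | base => simp
  | succ k _ ih =>
    have := hmono k (by omega)
    have := ih (by omega)
    push_cast; omega

theorem pureBetti_zero {N : ℕ} {d : ℕ → ℤ} (hmono : ∀ j < N, d j < d (j + 1)) (h0 : d 0 = 0) :
    pureBetti N d 0 = 1 := by
  have hpos : ∀ j ∈ Icc 1 N, (0 : ℚ) < d j := fun j hj => by
    have hj := mem_Icc.1 hj
    have := degree_add_sub_le hmono (Nat.zero_le j) hj.2
    exact_mod_cast (by omega : 0 < d j)
  have hs : (range (N + 1)).erase 0 = Icc 1 N := by
    ext j; simp only [mem_erase, mem_range, mem_Icc]; omega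
  have habs : ∀ j ∈ Icc 1 N, |(d 0 : ℚ) - d j| = d j := fun j hj => by
    rw [h0, Int.cast_zero, zero_sub, abs_neg, abs_of_pos (hpos j hj)]
  rw [pureBetti, hs, prod_congr rfl habs]
  exact div_self (prod_pos hpos).ne'

theorem pureBetti_succ {m n : ℕ} {d : ℕ → ℤ} (hmono : ∀ j < m + 1 + n, d j < d (j + 1))
    (h0 : d 0 = 0) :
    pureBetti (m + 1 + n) d (m + 1) =
      (∏ t ∈ range m, (d (t + 1) : ℚ) / (d (m + 1) - d (t + 1))) *
        ∏ t ∈ range n, (d (m + 2 + t) : ℚ) / (d (m + 2 + t) - d (m + 1)) := by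
  have hx : (0 : ℚ) < d (m + 1) := by
    have := degree_add_sub_le hmono (Nat.zero_le (m + 1)) (by omega)
    exact_mod_cast (by omega : 0 < d (m + 1))
  have hlow : ∀ t ∈ range m, |(d (m + 1) : ℚ) - d (t + 1)| = d (m + 1) - d (t + 1) :=
    fun t ht => by
      have ht := mem_range.1 ht
      have := degree_add_sub_le hmono (show t + 1 ≤ m + 1 by omega) (by omega)
      exact abs_of_nonneg (sub_nonneg.2 (by exact_mod_cast (by omega : d (t + 1) ≤ d (m + 1))))
  have hhigh : ∀ t ∈ range n,
      |(d (m + 1) : ℚ) - d (m + 2 + t)| = d (m + 2 + t) - d (m + 1) := fun t ht => by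
    have ht := mem_range.1 ht
    have := degree_add_sub_le hmono (show m + 1 ≤ m + 2 + t by omega) (by omega)
    rw [abs_sub_comm]
    exact abs_of_nonneg (sub_nonneg.2 (by exact_mod_cast (by omega : d (m + 1) ≤ d (m + 2 + t))))
  rw [pureBetti, prod_Icc_one_eq, prod_range_erase_succ, prod_congr rfl hlow,
    prod_congr rfl hhigh, h0, Int.cast_zero, sub_zero, abs_of_pos hx, prod_div_distrib,
    prod_div_distrib, mul_assoc, mul_assoc, mul_div_mul_left _ _ hx.ne', mul_div_mul_comm]

theorem choose_eq_ascFactorial_div (m n : ℕ) :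
    ((m + 1 + n).choose (m + 1) : ℚ) = (m + 2).ascFactorial n / n.factorial := by
  have h := Nat.ascFactorial_eq_factorial_mul_choose (m + 1) n
  rw [eq_div_iff (by positivity), Nat.choose_symm_add, mul_comm]
  exact_mod_cast h.symm

theorem pureBetti_succ_bounds {m n r : ℕ} {d : ℕ → ℤ}
    (hmono : ∀ j < m + 1 + n, d j < d (j + 1)) (h0 : d 0 = 0)
    (hdN : d (m + 1 + n) ≤ (m + 1 + n : ℕ) + r) :
    ((m + 1 + n).choose (m + 1) : ℚ) ≤ pureBetti (m + 1 + n) d (m + 1) * (m + 1 + n : ℕ) ^ r ∧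
      pureBetti (m + 1 + n) d (m + 1) ≤
        ((m + 1 + n).choose (m + 1) : ℚ) * (m + 1 + n : ℕ) ^ r := by
  have hx0 := degree_add_sub_le hmono (Nat.zero_le (m + 1)) (by omega)
  have hxN := degree_add_sub_le hmono (show m + 1 ≤ m + 1 + n by omega) le_rfl
  obtain ⟨s, hs⟩ : ∃ s : ℕ, d (m + 1) = m + 1 + s :=
    ⟨(d (m + 1) - (m + 1)).toNat, by push_cast at hx0; omega⟩
  obtain ⟨u, rfl⟩ : ∃ u, r = u + s := ⟨r - s, by push_cast at hxN hdN; omega⟩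
  have hsQ : (d (m + 1) : ℚ) = m + 1 + s := by exact_mod_cast congrArg (Int.cast (R := ℚ)) hs
  have hlow : ∀ t ∈ range m, (t + 1 : ℚ) ≤ d (t + 1) ∧ (d (t + 1) : ℚ) ≤ s + 1 + t ∧
      (t : ℚ) + 1 ≤ m := fun t ht => by
    have ht := mem_range.1 ht
    have h1 := degree_add_sub_le hmono (Nat.zero_le (t + 1)) (by omega)
    have h2 := degree_add_sub_le hmono (show t + 1 ≤ m + 1 by omega) (by omega)
    push_cast at h1 h2
    exact ⟨by exact_mod_cast (by omega : (t + 1 : ℤ) ≤ d (t + 1)),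
      by exact_mod_cast (by omega : d (t + 1) ≤ s + 1 + t), by exact_mod_cast ht⟩
  have hhigh : ∀ t ∈ range n, (m + s + 2 + t : ℚ) ≤ d (m + 2 + t) ∧
      (d (m + 2 + t) : ℚ) ≤ m + 2 + u + s + t := fun t ht => by
    have ht := mem_range.1 ht
    have h1 := degree_add_sub_le hmono (show m + 1 ≤ m + 2 + t by omega) (by omega)
    have h2 := degree_add_sub_le hmono (show m + 2 + t ≤ m + 1 + n by omega) le_rfl
    push_cast at h1 h2 hdN
    exact ⟨by exact_mod_cast (by omega : (m + s + 2 + t : ℤ) ≤ d (m + 2 + t)),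
      by exact_mod_cast (by omega : d (m + 2 + t) ≤ m + 2 + u + s + t)⟩
  have hm : ∏ t ∈ range m, ((m : ℚ) - t) = m.factorial := by
    simpa [Nat.one_ascFactorial] using prod_range_cast_add_sub 0 m
  have hone : ∀ k : ℕ, ∏ t ∈ range k, ((t : ℚ) + 1) = k.factorial := fun k => by
    simpa [Nat.one_ascFactorial, add_comm] using prod_range_cast_add 1 k
  have hsm : ∏ t ∈ range m, ((s : ℚ) + 1 + t) = ((s + 1).ascFactorial m : ℚ) := by
    simpa using prod_range_cast_add (s + 1) m
  have hpos : ∀ a k : ℕ, (0 : ℚ) < (a + 1).ascFactorial k := fun a k => by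
    exact_mod_cast Nat.ascFactorial_pos _ _
  have hmpos : (0 : ℚ) < m.factorial := by positivity
  have hnpos : (0 : ℚ) < n.factorial := by positivity
  rw [pureBetti_succ hmono h0, hsQ, choose_eq_ascFactorial_div]
  constructor
  · have hA : (m.factorial : ℚ) / (s + 1).ascFactorial m ≤
        ∏ t ∈ range m, (d (t + 1) : ℚ) / (m + 1 + s - d (t + 1)) := by
      rw [← hone, ← prod_range_cast_add_sub, ← prod_div_distrib]
      refine prod_le_prod (fun t ht => ?_) fun t ht => ?_ <;> obtain ⟨h1, h2, h3⟩ := hlow t ht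
      · exact div_nonneg (by positivity) (by linarith [Nat.cast_nonneg (α := ℚ) s])
      · exact div_le_div₀ (by linarith [Nat.cast_nonneg (α := ℚ) t]) h1 (by linarith)
          (by linarith)
    have hB : ((m + 2 + u + s).ascFactorial n : ℚ) / (u + 1).ascFactorial n ≤
        ∏ t ∈ range n, (d (m + 2 + t) : ℚ) / (d (m + 2 + t) - (m + 1 + s)) := by
      rw [← prod_range_cast_add, ← prod_range_cast_add, ← prod_div_distrib]
      refine prod_le_prod (fun t _ => by positivity) fun t ht => ?_
      obtain ⟨h1, h2⟩ := hhigh t ht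
      have ht0 := Nat.cast_nonneg (α := ℚ) t
      push_cast
      rw [div_le_div_iff₀ (by positivity) (by linarith)]
      nlinarith [mul_nonneg (sub_nonneg.2 h2) (by positivity : (0 : ℚ) ≤ m + 1 + s)]
    refine le_trans ?_ (mul_le_mul_of_nonneg_right (mul_le_mul hA hB (by positivity)
      ((by positivity : (0 : ℚ) ≤ _).trans hA)) (by positivity))
    rw [div_mul_div_comm, div_mul_eq_mul_div,
      div_le_div_iff₀ hnpos (mul_pos (hpos _ _) (hpos _ _))]
    have h := ascFactorial_mul_ascFactorial_mul_ascFactorial_le m n u s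
    have h' :
      (((s + 1).ascFactorial m * (u + 1).ascFactorial n * (m + 2).ascFactorial n : ℕ) : ℚ) ≤
      ((m.factorial * (m + 2 + u + s).ascFactorial n * n.factorial * (m + 1 + n) ^ (u + s) : ℕ) :
        ℚ) := by exact_mod_cast h
    push_cast at h' ⊢
    linarith
  · have hA : ∏ t ∈ range m, (d (t + 1) : ℚ) / (m + 1 + s - d (t + 1)) ≤
        ((s + 1).ascFactorial m : ℚ) / m.factorial := by
      rw [← hsm, ← hm, ← prod_div_distrib]
      refine prod_le_prod (fun t ht => ?_) fun t ht => ?_ <;>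
        obtain ⟨h1, h2, h3⟩ := hlow t ht <;> have ht0 := Nat.cast_nonneg (α := ℚ) t
      · exact div_nonneg (by linarith) (by linarith)
      · exact div_le_div₀ (by positivity) h2 (by linarith) (by linarith)
    have hB : ∏ t ∈ range n, (d (m + 2 + t) : ℚ) / (d (m + 2 + t) - (m + 1 + s)) ≤
        ((m + s + 2).ascFactorial n : ℚ) / n.factorial := by
      rw [← hone, ← prod_range_cast_add, ← prod_div_distrib]
      refine prod_le_prod (fun t ht => ?_) fun t ht => ?_ <;>
        obtain ⟨h1, h2⟩ := hhigh t ht <;> have ht0 := Nat.cast_nonneg (α := ℚ) t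
      · exact div_nonneg ((by positivity : (0 : ℚ) ≤ _).trans h1) (by linarith)
      · push_cast
        rw [div_le_div_iff₀ (by linarith) (by positivity)]
        nlinarith [mul_nonneg (sub_nonneg.2 h1) (by positivity : (0 : ℚ) ≤ m + 1 + s)]
    refine (mul_le_mul hA hB (prod_nonneg fun t ht => ?_) (by positivity)).trans ?_
    · obtain ⟨h1, h2⟩ := hhigh t ht
      exact div_nonneg ((by positivity : (0 : ℚ) ≤ _).trans h1)
        (by linarith [Nat.cast_nonneg (α := ℚ) t])
    have h := (ascFactorial_mul_ascFactorial_le_mul_pow m n s).trans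
      (Nat.mul_le_mul_left _ (Nat.pow_le_pow_right (by omega) (Nat.le_add_left s u)))
    have h' : (((s + 1).ascFactorial m * (m + s + 2).ascFactorial n : ℕ) : ℚ) ≤
      ((m.factorial * (m + 2).ascFactorial n * (m + 1 + n) ^ (u + s) : ℕ) : ℚ) := by
      exact_mod_cast h
    rw [div_mul_div_comm, div_mul_eq_mul_div, div_le_div_iff₀ (by positivity) hnpos]
    push_cast at h' ⊢
    nlinarith [mul_le_mul_of_nonneg_right h' hnpos.le]

/-- for any degree sequence `d` of length `N` with `d 0 = 0` and
`d N ≤ N + r`, we have `binom(N,i) · N^(−r) ≤ β_i(π_d) ≤ binom(N,i) · N^r`. -/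
theorem keyLemma (N r i : ℕ) (hN : 1 ≤ N) (hi : i ≤ N)
    (d : ℕ → ℤ) (hmono : ∀ j < N, d j < d (j + 1))
    (h0 : d 0 = 0) (hdN : d N ≤ N + r) :
    (N.choose i : ℚ) * (N : ℚ) ^ (-(r : ℤ)) ≤ pureBetti N d i ∧
      pureBetti N d i ≤ (N.choose i : ℚ) * (N : ℚ) ^ r := by
  have hNr : (0 : ℚ) < (N : ℚ) ^ r := pow_pos (by exact_mod_cast hN) r
  rw [zpow_neg, zpow_natCast, ← div_eq_mul_inv, div_le_iff₀ hNr]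
  rcases i with _ | m
  · have h1 : (1 : ℚ) ≤ (N : ℚ) ^ r := one_le_pow₀ (by exact_mod_cast hN)
    simpa [pureBetti_zero hmono h0] using h1
  · obtain ⟨n, rfl⟩ := Nat.exists_eq_add_of_le hi
    exact pureBetti_succ_bounds hmono h0 hdN
end

section
/- Fix integers N ≥ 1, r ≥ 0, 0 ≤ i ≤ N, and 0 ≤ a ≤ r. Among all degree sequences d = (d_0, …, d_N) with d_0 = 0, d_i = i + a, and d_N ≤ N + r, the quantity β_i(π_d) is maximized by the degree sequence d_max = (0, a+1, a+2, …, N+a); that is, for every such d one has β_i(π_d) ≤ β_i(π_{d_max}). -/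
theorem sub_le_sub_of_strict_steps {N : ℕ} {d : ℕ → ℤ} (hmono : ∀ j < N, d j < d (j + 1))
    {j k : ℕ} (hjk : j ≤ k) (hk : k ≤ N) : (k : ℤ) - j ≤ d k - d j := by
  induction k, hjk using Nat.le_induction with
  | base => simp
  | succ k hjk ih =>
    have h1 := ih (by omega)
    have h2 := hmono k (by omega)
    push_cast
    omega

theorem pureBetti_zero_right {N : ℕ} {d : ℕ → ℤ} (h0 : d 0 = 0)
    (hpos : ∀ j ∈ Finset.Icc 1 N, 0 < d j) : pureBetti N d 0 = 1 := by
  have hset : (Finset.range (N + 1)).erase 0 = Finset.Icc 1 N := by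
    ext j
    simp only [Finset.mem_erase, Finset.mem_range, Finset.mem_Icc]
    omega
  have hq : ∀ j ∈ Finset.Icc 1 N, (0 : ℚ) < d j := fun j hj => by exact_mod_cast hpos j hj
  have hden : ∏ j ∈ Finset.Icc 1 N, |(d 0 : ℚ) - (d j : ℚ)| = ∏ j ∈ Finset.Icc 1 N, (d j : ℚ) :=
    Finset.prod_congr rfl fun j hj => by simp [h0, abs_of_pos (hq j hj)]
  rw [pureBetti, hset, hden, div_self (Finset.prod_pos hq).ne']

theorem pureBetti_eq_mul_prod_div {N i : ℕ} {d : ℕ → ℤ} (h0 : d 0 = 0) (hi : 1 ≤ i)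
    (hiN : i ≤ N) :
    pureBetti N d i =
      (d i : ℚ) / |(d i : ℚ)| *
        ∏ j ∈ (Finset.Icc 1 N).erase i, (d j : ℚ) / |(d i : ℚ) - (d j : ℚ)| := by
  have hset : (Finset.range (N + 1)).erase i = insert 0 ((Finset.Icc 1 N).erase i) := by
    ext j
    simp only [Finset.mem_erase, Finset.mem_range, Finset.mem_Icc, Finset.mem_insert]
    omega
  rw [pureBetti, hset, Finset.prod_insert (by simp),
    ← Finset.mul_prod_erase _ _ (Finset.mem_Icc.2 ⟨hi, hiN⟩), Finset.prod_div_distrib,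
    mul_div_mul_comm, h0, Int.cast_zero, sub_zero]

theorem div_abs_sub_le_of_le_of_lt {c x y : ℚ} (hy : 0 ≤ y) (hxy : x ≤ y) (hyc : y < c) :
    x / |c - x| ≤ y / |c - y| := by
  rw [abs_of_pos (by linarith), abs_of_pos (by linarith)]
  exact div_le_div₀ hy hxy (by linarith) (by linarith)

theorem div_abs_sub_le_of_lt_of_le {c x y : ℚ} (hc : 0 ≤ c) (hcy : c < y) (hyx : y ≤ x) :
    x / |c - x| ≤ y / |c - y| := by
  rw [abs_of_neg (by linarith), abs_of_neg (by linarith),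
    div_le_div_iff₀ (by linarith) (by linarith)]
  nlinarith [mul_nonneg hc (sub_nonneg.2 hyx)]

/-- among degree sequences with `d 0 = 0`, `d i = i + a` and
`d N ≤ N + r`, the value `β_i(π_d)` is maximized by `d_max = (0, a+1, …, N+a)`. -/
theorem betti_le_dmax (N r a i : ℕ) (hN : 1 ≤ N) (hi : i ≤ N) (ha : a ≤ r)
    (d : ℕ → ℤ) (hmono : ∀ j < N, d j < d (j + 1))
    (h0 : d 0 = 0) (hdi : d i = (i : ℤ) + a) (hdN : d N ≤ N + r) :
    pureBetti N d i ≤ pureBetti N (fun j => if j = 0 then 0 else (j : ℤ) + a) i := by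
  have hpos : ∀ j ∈ Finset.Icc 1 N, 0 < d j := by
    intro j hj
    obtain ⟨hj1, hjN⟩ := Finset.mem_Icc.1 hj
    have := sub_le_sub_of_strict_steps hmono (Nat.zero_le j) hjN
    push_cast at this
    omega
  rcases Nat.eq_zero_or_pos i with rfl | hi1
  · rw [pureBetti_zero_right h0 hpos, pureBetti_zero_right (if_pos rfl)]
    intro j hj
    have := (Finset.mem_Icc.1 hj).1
    rw [if_neg (by omega)]
    omega
  · rw [pureBetti_eq_mul_prod_div h0 hi1 hi, pureBetti_eq_mul_prod_div (if_pos rfl) hi1 hi,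
      if_neg (by omega : i ≠ 0), hdi]
    refine mul_le_mul_of_nonneg_left (Finset.prod_le_prod ?_ ?_) ?_
    · intro j hj
      have : (0 : ℚ) < d j := by exact_mod_cast hpos j (Finset.mem_of_mem_erase hj)
      positivity
    · intro j hj
      obtain ⟨hji, hj⟩ := Finset.mem_erase.1 hj
      obtain ⟨hj1, hjN⟩ := Finset.mem_Icc.1 hj
      rw [if_neg (by omega : j ≠ 0)]
      rcases lt_or_gt_of_ne hji with hlt | hlt
      · have := sub_le_sub_of_strict_steps hmono hlt.le hi
        apply div_abs_sub_le_of_le_of_lt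
        · positivity
        · exact_mod_cast (by omega : d j ≤ (j : ℤ) + a)
        · exact_mod_cast (by omega : (j : ℤ) + a < (i : ℤ) + a)
      · have := sub_le_sub_of_strict_steps hmono hlt.le hjN
        apply div_abs_sub_le_of_lt_of_le
        · positivity
        · exact_mod_cast (by omega : (i : ℤ) + a < (j : ℤ) + a)
        · exact_mod_cast (by omega : (j : ℤ) + a ≤ d j)
    · positivity
end

section
/- Fix integers N ≥ 1, r ≥ 0, 1 ≤ i ≤ N, and 0 ≤ a ≤ r. Among all degree sequences d = (d_0, …, d_N) with d_0 = 0, d_i = i + a, and d_N ≤ N + r, the quantity β_i(π_d) is minimized by the degree sequence d_min = (0, 1, 2, …, i−1, i+a, i+r+1, i+r+2, …, N+r); that is, for every such d one has β_i(π_d) ≥ β_i(π_{d_min}). -/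
/-- A strictly increasing integer sequence grows by at least one at each step. -/
theorem add_le_of_forall_lt_succ {N : ℕ} {d : ℕ → ℤ} (hmono : ∀ j < N, d j < d (j + 1))
    {j k : ℕ} (hjk : j ≤ k) (hk : k ≤ N) : d j + k ≤ d k + j := by
  induction k, hjk using Nat.le_induction with
  | base => rfl
  | succ k _ ih =>
    have h := ih (by omega)
    have h' := hmono k (by omega)
    push_cast
    omega

/-- When `d 0 = 0`, the factors of `β_i(π_d)` at `0` and `i` cancel. -/
theorem pureBetti_eq_prod {N i : ℕ} {d : ℕ → ℤ} (hi1 : 1 ≤ i) (hiN : i ≤ N) (h0 : d 0 = 0)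
    (hdi : 0 < d i) :
    pureBetti N d i =
      ∏ j ∈ (Finset.Icc 1 N).erase i, (d j : ℚ) / |(d i : ℚ) - (d j : ℚ)| := by
  have hmem : i ∈ Finset.Icc 1 N := Finset.mem_Icc.2 ⟨hi1, hiN⟩
  have hset : (Finset.range (N + 1)).erase i = insert 0 ((Finset.Icc 1 N).erase i) := by
    ext j
    simp only [Finset.mem_erase, Finset.mem_range, Finset.mem_insert, Finset.mem_Icc]
    omega
  have hpos : (0 : ℚ) < d i := by exact_mod_cast hdi
  rw [pureBetti, hset, Finset.prod_insert (by simp), ← Finset.mul_prod_erase _ _ hmem,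
    Finset.prod_div_distrib, h0, Int.cast_zero, sub_zero, abs_of_pos hpos,
    mul_div_mul_left _ _ hpos.ne']

/-- among degree sequences with `d 0 = 0`, `d i = i + a` and
`d N ≤ N + r`, the value `β_i(π_d)` is minimized by
`d_min = (0, 1, …, i−1, i+a, i+r+1, …, N+r)`. -/
theorem betti_ge_dmin (N r a i : ℕ) (hN : 1 ≤ N) (hi1 : 1 ≤ i) (hiN : i ≤ N) (ha : a ≤ r)
    (d : ℕ → ℤ) (hmono : ∀ j < N, d j < d (j + 1))
    (h0 : d 0 = 0) (hdi : d i = (i : ℤ) + a) (hdN : d N ≤ N + r) :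
    pureBetti N (fun j => if j < i then (j : ℤ) else if j = i then (i : ℤ) + a
      else (j : ℤ) + r) i ≤ pureBetti N d i := by
  rw [pureBetti_eq_prod hi1 hiN h0 (by omega),
    pureBetti_eq_prod hi1 hiN (by simp; omega) (by simp; omega)]
  have ha' : (a : ℚ) ≤ r := by exact_mod_cast ha
  have hdi' : (d i : ℚ) = i + a := by exact_mod_cast hdi
  refine Finset.prod_le_prod (fun j _ => ?_) fun j hj => ?_
  · refine div_nonneg ?_ (abs_nonneg _)
    split_ifs <;> push_cast <;> positivity
  · obtain ⟨hji, hj⟩ := Finset.mem_erase.1 hj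
    obtain ⟨hj1, hjN⟩ := Finset.mem_Icc.1 hj
    simp only [lt_irrefl, if_false, if_true, hji, hdi']
    rcases lt_or_gt_of_ne hji with h | h
    · have hle : (j : ℚ) ≤ d j := by
        have := add_le_of_forall_lt_succ hmono (Nat.zero_le j) hjN
        exact_mod_cast (by omega : (j : ℤ) ≤ d j)
      have hlt : (d j : ℚ) < i + a := by
        have := add_le_of_forall_lt_succ hmono h.le hiN
        exact_mod_cast (by omega : d j < i + a)
      have hj0 : (0 : ℚ) ≤ j := j.cast_nonneg
      rw [if_pos h]
      push_cast
      rw [abs_of_pos (by linarith), abs_of_pos (by linarith)]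
      exact div_le_div₀ (by linarith) hle (by linarith) (by linarith)
    · have hle : (d j : ℚ) ≤ j + r := by
        have := add_le_of_forall_lt_succ hmono hjN le_rfl
        exact_mod_cast (by omega : d j ≤ j + r)
      have hlt : (i + a : ℚ) < d j := by
        have := add_le_of_forall_lt_succ hmono h.le hjN
        exact_mod_cast (by omega : (i + a : ℤ) < d j)
      have hc : (0 : ℚ) ≤ i + a := by positivity
      rw [if_neg h.not_gt]
      push_cast
      rw [abs_of_neg (by linarith), abs_of_neg (by linarith),
        div_le_div_iff₀ (by linarith) (by linarith)]
      nlinarith [mul_nonneg hc (sub_nonneg.2 hle)]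
end

section
/- Fix integers N ≥ 1, 1 ≤ i ≤ N, and a ≥ 0, and let d_max be the degree sequence (0, a+1, a+2, …, N+a). Then β_i(π_{d_max}) = binom(N,i) · ((N+a)(N+a−1)⋯(N+1)/a!) · (i/(i+a)); equivalently, β_i(π_{d_max}) = binom(N,i) · binom(N+a, a) · i/(i+a) as rational numbers. -/
open Finset in
theorem Finset.prod_erase_range_add {M : Type*} [CommMonoid M] (f : ℕ → M) (i m : ℕ) :
    ∏ j ∈ (range (i + 1 + m)).erase i, f j =
      (∏ j ∈ range i, f j) * ∏ j ∈ range m, f (i + 1 + j) := by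
  have h : ∏ j ∈ (range (i + 1 + m)).erase i, f j =
      ∏ j ∈ (range (i + 1 + m)).erase i, Function.update f i 1 j :=
    prod_congr rfl fun j hj => by rw [Function.update_of_ne (ne_of_mem_erase hj)]
  rw [h, prod_erase _ (Function.update_self i 1 f), prod_range_add, prod_range_succ,
    Function.update_self, mul_one]
  congr 1
  · exact prod_congr rfl fun j hj => Function.update_of_ne (mem_range.1 hj).ne _ _
  · exact prod_congr rfl fun j _ => Function.update_of_ne (by lia) _ _

theorem Nat.cast_factorial_mul_prod_Icc_add (n k : ℕ) :
    (n.factorial : ℚ) * ∏ j ∈ Finset.Icc 1 k, ((j : ℚ) + n) = (n + k).factorial := by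
  induction k with
  | zero => simp
  | succ k ih =>
    rw [Finset.prod_Icc_succ_top (by lia), ← mul_assoc, ih, ← add_assoc, Nat.factorial_succ]
    push_cast
    ring

theorem Nat.cast_factorial_mul_prod_Icc (n k : ℕ) :
    (n.factorial : ℚ) * ∏ j ∈ Finset.Icc (n + 1) (n + k), (j : ℚ) = (n + k).factorial := by
  induction k with
  | zero => simp
  | succ k ih =>
    rw [← add_assoc, Finset.prod_Icc_succ_top (by lia), ← mul_assoc, ih, Nat.factorial_succ]
    push_cast
    ring

theorem Nat.cast_prod_range_sub (k : ℕ) :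
    ∏ j ∈ Finset.range k, ((k : ℚ) - j) = k.factorial := by
  rw [← Finset.prod_range_add_one_eq_factorial, ← Finset.prod_range_reflect]
  push_cast
  refine Finset.prod_congr rfl fun j hj => ?_
  have := Finset.mem_range.1 hj
  rw [Nat.sub_sub, Nat.cast_sub (by lia)]
  push_cast
  ring

/-- The denominator of `pureBetti` for the degree sequence `(0, a + 1, …, a + N)`, with
`i = k + 1` and `N = k + 1 + m`. -/
theorem prod_abs_sub_dmax (a k m : ℕ) :
    ∏ j ∈ (Finset.range (k + 1 + 1 + m)).erase (k + 1),
      |(((if k + 1 = 0 then 0 else ((k + 1 : ℕ) : ℤ) + a : ℤ)) : ℚ) -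
        ((if j = 0 then 0 else (j : ℤ) + a : ℤ) : ℚ)| =
      k.factorial * ((k : ℚ) + 1 + a) * m.factorial := by
  rw [Finset.prod_erase_range_add, Finset.prod_range_succ']
  congr 1
  · congr 1
    · rw [← Nat.cast_prod_range_sub]
      refine Finset.prod_congr rfl fun j hj => ?_
      have : (j : ℚ) ≤ k := by exact_mod_cast (Finset.mem_range.1 hj).le
      simp only [Nat.add_eq_zero_iff, one_ne_zero, and_false, if_false]
      push_cast
      rw [abs_of_nonneg (by linarith)]
      ring
    · simp only [Nat.add_eq_zero_iff, one_ne_zero, and_false, if_false, if_true]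
      push_cast
      rw [sub_zero, abs_of_nonneg (by positivity)]
  · rw [← Finset.prod_range_add_one_eq_factorial]
    push_cast
    refine Finset.prod_congr rfl fun j _ => ?_
    have : (0 : ℚ) ≤ j := j.cast_nonneg
    rw [if_neg (show ¬k + 1 + 1 + j = 0 by lia), abs_of_nonpos (by linarith)]
    ring

/-- for `d_max = (0, a+1, a+2, …, N+a)` we have
`β_i(π_{d_max}) = binom(N,i) · ((N+a)⋯(N+1)/a!) · (i/(i+a)) = binom(N,i) · binom(N+a,a) · i/(i+a)`. -/
theorem betti_dmax_eq (N a i : ℕ) (hN : 1 ≤ N) (hi1 : 1 ≤ i) (hiN : i ≤ N) :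
    pureBetti N (fun j => if j = 0 then 0 else (j : ℤ) + a) i
      = (N.choose i : ℚ) * ((∏ j ∈ Finset.Icc (N + 1) (N + a), (j : ℚ)) / a.factorial)
          * ((i : ℚ) / ((i : ℚ) + a)) ∧
    pureBetti N (fun j => if j = 0 then 0 else (j : ℤ) + a) i
      = (N.choose i : ℚ) * ((N + a).choose a : ℚ) * (i : ℚ) / ((i : ℚ) + a) := by
  obtain ⟨k, rfl⟩ : ∃ k, i = k + 1 := ⟨i - 1, by lia⟩
  obtain ⟨m, rfl⟩ := Nat.exists_eq_add_of_le hiN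
  have hnum : ∏ j ∈ Finset.Icc 1 (k + 1 + m), ((if j = 0 then 0 else (j : ℤ) + a : ℤ) : ℚ) =
      (k + 1 + m + a).factorial / a.factorial := by
    rw [eq_div_iff (by positivity), mul_comm, add_comm (k + 1 + m) a,
      ← Nat.cast_factorial_mul_prod_Icc_add]
    congr 1
    refine Finset.prod_congr rfl fun j hj => ?_
    rw [if_neg (by have := (Finset.mem_Icc.1 hj).1; lia)]
    push_cast
    rfl
  have hprod : ∏ j ∈ Finset.Icc (k + 1 + m + 1) (k + 1 + m + a), (j : ℚ) =
      (k + 1 + m + a).factorial / (k + 1 + m).factorial := by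
    rw [eq_div_iff (by positivity), mul_comm, Nat.cast_factorial_mul_prod_Icc]
  have hbetti : pureBetti (k + 1 + m) (fun j => if j = 0 then 0 else (j : ℤ) + a) (k + 1) =
      (k + 1 + m + a).factorial / a.factorial /
        (k.factorial * ((k : ℚ) + 1 + a) * m.factorial) := by
    rw [pureBetti, hnum, show k + 1 + m + 1 = k + 1 + 1 + m by ring]
    exact congrArg _ (prod_abs_sub_dmax a k m)
  have hk : (k : ℚ) + 1 + a ≠ 0 := by positivity
  rw [hbetti, hprod, Nat.cast_add_choose ℚ (a := k + 1),
    add_comm (k + 1 + m) a, Nat.cast_add_choose ℚ (a := a), Nat.factorial_succ k]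
  push_cast
  constructor <;> field_simp
end

section
/- Fix integers N ≥ 1, 1 ≤ i ≤ N, and a ≥ 0, and let d_max be the degree sequence (0, a+1, a+2, …, N+a). Then β_i(π_{d_max}) ≤ binom(N,i) · N^a. -/
/-- A product over `{0, …, m + n} \ {m}` splits into the factors below and above `m`. -/
theorem prod_range_erase_eq_mul {M : Type*} [CommMonoid M] (f : ℕ → M) (m n : ℕ) :
    ∏ j ∈ (Finset.range (m + n + 1)).erase m, f j =
      (∏ j ∈ Finset.range m, f j) * ∏ k ∈ Finset.range n, f (m + 1 + k) := by
  induction n with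
  | zero =>
    rw [add_zero, Finset.range_add_one, Finset.erase_insert Finset.notMem_range_self]
    simp
  | succ n ih =>
    rw [← add_assoc, Finset.range_add_one, Finset.erase_insert_of_ne (by omega),
      Finset.prod_insert (by simp), ih, Finset.prod_range_succ, add_right_comm m n 1,
      mul_comm, mul_assoc]

theorem ascFactorial_succ_le_factorial_mul_pow (a m : ℕ) :
    (a + 1).ascFactorial m ≤ m.factorial * (m + 1) ^ a := by
  induction a with
  | zero => simp [Nat.one_ascFactorial]
  | succ a ih =>
    have h := Nat.succ_ascFactorial (a + 1) m
    refine le_of_mul_le_mul_left ?_ (Nat.add_one_pos a)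
    calc (a + 1) * (a + 1 + 1).ascFactorial m
        = (a + 1 + m) * (a + 1).ascFactorial m := h
      _ ≤ ((a + 1) * (m + 1)) * (m.factorial * (m + 1) ^ a) :=
          Nat.mul_le_mul (by nlinarith [Nat.zero_le (a * m)]) ih
      _ = (a + 1) * (m.factorial * (m + 1) ^ (a + 1)) := by ring

theorem prod_Icc_one_add_eq_ascFactorial (a N : ℕ) :
    ∏ j ∈ Finset.Icc 1 N, (j + a) = (a + 1).ascFactorial N := by
  induction N with
  | zero => simp
  | succ N ih =>
    rw [Finset.prod_Icc_succ_top (by omega), ih, Nat.ascFactorial_succ]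
    ring

theorem prod_range_sub_eq_factorial (m : ℕ) :
    ∏ k ∈ Finset.range m, ((m : ℚ) - k) = m.factorial := by
  rw [← Nat.descFactorial_self, Nat.descFactorial_eq_prod_range]
  push_cast
  exact Finset.prod_congr rfl fun k hk => by
    rw [Nat.cast_sub (Finset.mem_range.mp hk).le]

/-- Closed form of the Betti numbers of the degree sequence `(0, a + 1, …, a + N)`. -/
theorem pureBetti_dmax (a m n : ℕ) :
    pureBetti (m + 1 + n) (fun j => if j = 0 then 0 else (j : ℤ) + a) (m + 1) =
      (a + 1).ascFactorial (m + 1 + n) / (m.factorial * (m + 1 + a) * n.factorial) := by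
  unfold pureBetti
  congr 1
  · rw [← prod_Icc_one_add_eq_ascFactorial, Nat.cast_prod]
    refine Finset.prod_congr rfl fun j hj => ?_
    have : j ≠ 0 := by have := (Finset.mem_Icc.mp hj).1; omega
    simp [this]
  · rw [prod_range_erase_eq_mul, Finset.prod_range_succ']
    congr 1
    · congr 1
      · rw [← prod_range_sub_eq_factorial]
        refine Finset.prod_congr rfl fun k hk => ?_
        have hk : (k : ℚ) ≤ m := by exact_mod_cast (Finset.mem_range.mp hk).le
        simp only [Nat.add_eq_zero_iff, one_ne_zero, and_false, if_false]
        push_cast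
        rw [abs_of_nonneg (by linarith)]
        ring
      · simp only [Nat.add_eq_zero_iff, one_ne_zero, and_false, if_false, if_true]
        push_cast [sub_zero]
        rw [abs_of_nonneg (by positivity)]
    · rw [← Finset.prod_range_add_one_eq_factorial]
      push_cast
      refine Finset.prod_congr rfl fun k _ => ?_
      simp only [Nat.add_eq_zero_iff, one_ne_zero, and_false, false_and, if_false]
      rw [abs_of_nonpos (by linarith [(Nat.cast_nonneg k : (0 : ℚ) ≤ k)])]
      ring

/-- for `d_max = (0, a+1, a+2, …, N+a)` we have
`β_i(π_{d_max}) ≤ binom(N,i) · N^a`. -/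
theorem betti_dmax_le (N a i : ℕ) (hN : 1 ≤ N) (hi1 : 1 ≤ i) (hiN : i ≤ N) :
    pureBetti N (fun j => if j = 0 then 0 else (j : ℤ) + a) i
      ≤ (N.choose i : ℚ) * (N : ℚ) ^ a := by
  obtain ⟨m, rfl⟩ := Nat.exists_eq_add_of_le' hi1
  obtain ⟨n, rfl⟩ := Nat.exists_eq_add_of_le hiN
  rw [pureBetti_dmax, div_le_iff₀ (by positivity)]
  have hchoose := Nat.add_choose_mul_factorial_mul_factorial (m + 1) n
  have hbound := ascFactorial_succ_le_factorial_mul_pow a (m + n)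
  have hasc : (a + 1).ascFactorial (m + 1 + n) =
      (a + 1 + (m + n)) * (a + 1).ascFactorial (m + n) := by
    rw [add_right_comm m 1 n, Nat.ascFactorial_succ]
  rw [← Nat.choose_symm_add, Nat.factorial_succ, add_right_comm m 1 n,
    Nat.factorial_succ] at hchoose
  rw [hasc, add_right_comm m 1 n]
  norm_cast
  refine le_of_mul_le_mul_left ?_ (Nat.add_one_pos m)
  calc (m + 1) * ((a + 1 + (m + n)) * (a + 1).ascFactorial (m + n))
      = ((m + 1) * (a + 1 + (m + n))) * (a + 1).ascFactorial (m + n) := by ring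
    _ ≤ ((m + n + 1) * (m + 1 + a)) * ((m + n).factorial * (m + n + 1) ^ a) :=
        Nat.mul_le_mul (by nlinarith [Nat.zero_le (n * a)]) hbound
    _ = ((m + n + 1) * (m + n).factorial) * ((m + 1 + a) * (m + n + 1) ^ a) := by ring
    _ = (m + 1) * ((m + n + 1).choose (m + 1) * (m + n + 1) ^ a *
          (m.factorial * (m + 1 + a) * n.factorial)) := by
        rw [← hchoose]
        ring
end

section
/- Fix integers N ≥ 1, r ≥ 0, 1 ≤ i ≤ N, and 0 ≤ a ≤ r, and let d_min be the degree sequence (0, 1, 2, …, i−1, i+a, i+r+1, i+r+2, …, N+r). Then β_i(π_{d_min}) ≥ binom(N,i) · N^(−r). -/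
theorem Nat.choose_add_right_le_pow (k a : ℕ) : (k + a).choose a ≤ (k + 1) ^ a := by
  induction a with
  | zero => simp
  | succ a ih =>
    have h := Nat.add_one_mul_choose_eq (k + a) a
    have h2 : k + a + 1 ≤ (k + 1) * (a + 1) := by nlinarith [Nat.zero_le (k * a)]
    refine Nat.le_of_mul_le_mul_right (c := a + 1) ?_ (Nat.succ_pos a)
    calc (k + (a + 1)).choose (a + 1) * (a + 1) = (k + a + 1) * (k + a).choose a := h.symm
      _ ≤ ((k + 1) * (a + 1)) * (k + 1) ^ a := Nat.mul_le_mul h2 ih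
      _ = (k + 1) ^ (a + 1) * (a + 1) := by ring

theorem prod_range_add_one_sub (i a : ℕ) :
    (∏ j ∈ Finset.range i, ((i : ℚ) + a - j)) * (a.factorial : ℚ) = ((i + a).factorial : ℚ) := by
  induction i with
  | zero => simp
  | succ i ih =>
    rw [Finset.prod_range_succ', show i + 1 + a = (i + a) + 1 by ring, Nat.factorial_succ]
    push_cast
    rw [← ih]
    simp only [add_sub_add_right_eq_sub, add_right_comm (i : ℚ) 1 (a : ℚ)]
    ring

theorem prod_range_add_add_one (c m : ℕ) :
    (∏ j ∈ Finset.range m, ((c : ℚ) + j + 1)) * (c.factorial : ℚ) = ((c + m).factorial : ℚ) := by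
  induction m with
  | zero => simp
  | succ m ih =>
    rw [Finset.prod_range_succ, ← add_assoc, Nat.factorial_succ]
    push_cast
    rw [← ih]
    ring

theorem prod_Icc_one_eq_split {M : Type*} [CommMonoid M] (f : ℕ → M) (k m : ℕ) :
    ∏ j ∈ Finset.Icc 1 (k + 1 + m), f j =
      (∏ j ∈ Finset.range k, f (j + 1)) * f (k + 1) *
        ∏ j ∈ Finset.range m, f (k + 1 + j + 1) := by
  induction m with
  | zero =>
    rw [← Finset.Ico_add_one_right_eq_Icc, Finset.prod_Ico_eq_prod_range]
    simp [Finset.prod_range_succ, add_comm]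
  | succ m ih =>
    rw [← add_assoc, Finset.prod_Icc_succ_top (by omega), ih, Finset.prod_range_succ, mul_assoc]

theorem prod_range_erase_eq_split {M : Type*} [CommMonoid M] (f : ℕ → M) (i m : ℕ) :
    ∏ j ∈ (Finset.range (i + m + 1)).erase i, f j =
      (∏ j ∈ Finset.range i, f j) * ∏ j ∈ Finset.range m, f (i + j + 1) := by
  induction m with
  | zero => simp [Finset.range_add_one]
  | succ m ih =>
    rw [← add_assoc, Finset.range_add_one, Finset.erase_insert_of_ne (by omega),
      Finset.prod_insert (by simp), ih, Finset.prod_range_succ]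
    rw [mul_comm, mul_assoc]

theorem pureBetti_dmin_eq (k m a b : ℕ) :
    pureBetti (k + 1 + m) (fun j => if j < k + 1 then (j : ℤ) else
        if j = k + 1 then ((k + 1 : ℕ) : ℤ) + a else (j : ℤ) + (a + b : ℕ)) (k + 1) =
      ((k + 1 + m + (a + b)).choose m : ℚ) / ((k + a).choose a * (m + b).choose b) := by
  unfold pureBetti
  rw [prod_Icc_one_eq_split, prod_range_erase_eq_split]
  have n1 : ∏ j ∈ Finset.range k, (((if j + 1 < k + 1 then ((j + 1 : ℕ) : ℤ) else
      if j + 1 = k + 1 then ((k + 1 : ℕ) : ℤ) + a else ((j + 1 : ℕ) : ℤ) + (a + b : ℕ)) : ℤ) : ℚ)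
      = (k.factorial : ℚ) := by
    rw [← Finset.prod_range_add_one_eq_factorial, Nat.cast_prod]
    refine Finset.prod_congr rfl fun j hj => ?_
    rw [if_pos (by simpa using hj)]
    push_cast
    rfl
  have n2 : ∏ j ∈ Finset.range m, (((if k + 1 + j + 1 < k + 1 then ((k + 1 + j + 1 : ℕ) : ℤ) else
      if k + 1 + j + 1 = k + 1 then ((k + 1 : ℕ) : ℤ) + a
        else ((k + 1 + j + 1 : ℕ) : ℤ) + (a + b : ℕ)) : ℤ) : ℚ)
      = ∏ j ∈ Finset.range m, (((k + 1 + (a + b) : ℕ) : ℚ) + j + 1) := by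
    refine Finset.prod_congr rfl fun j _ => ?_
    rw [if_neg (by omega), if_neg (by omega)]
    push_cast
    ring
  have d1 : ∏ j ∈ Finset.range (k + 1), |(((k + 1 : ℕ) : ℤ) + a : ℚ) -
      (((if j < k + 1 then (j : ℤ) else
      if j = k + 1 then ((k + 1 : ℕ) : ℤ) + a else (j : ℤ) + (a + b : ℕ)) : ℤ) : ℚ)|
      = ∏ j ∈ Finset.range (k + 1), (((k + 1 : ℕ) : ℚ) + a - j) := by
    refine Finset.prod_congr rfl fun j hj => ?_
    have hj' := Finset.mem_range.1 hj
    have : (j : ℚ) ≤ ((k + 1 : ℕ) : ℚ) := by exact_mod_cast hj'.le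
    rw [if_pos hj']
    push_cast at this ⊢
    rw [abs_of_nonneg (by linarith [Nat.cast_nonneg (α := ℚ) a])]
  have d2 : ∏ j ∈ Finset.range m, |(((k + 1 : ℕ) : ℤ) + a : ℚ) -
      (((if k + 1 + j + 1 < k + 1 then ((k + 1 + j + 1 : ℕ) : ℤ) else
      if k + 1 + j + 1 = k + 1 then ((k + 1 : ℕ) : ℤ) + a
        else ((k + 1 + j + 1 : ℕ) : ℤ) + (a + b : ℕ)) : ℤ) : ℚ)|
      = ∏ j ∈ Finset.range m, ((b : ℚ) + j + 1) := by
    refine Finset.prod_congr rfl fun j _ => ?_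
    rw [if_neg (by omega), if_neg (by omega), abs_sub_comm]
    push_cast
    rw [abs_of_nonneg] <;> ring_nf
    positivity
  simp only [lt_irrefl, if_false, if_true, Int.cast_add, Int.cast_natCast] at n1 n2 d1 d2 ⊢
  rw [n1, n2, d1, d2]
  have e1 := prod_range_add_one_sub (k + 1) a
  have e2 := prod_range_add_add_one b m
  have e3 := prod_range_add_add_one (k + 1 + (a + b)) m
  have fpos : ∀ n : ℕ, (n.factorial : ℚ) ≠ 0 := fun n => by exact_mod_cast n.factorial_ne_zero
  rw [← eq_div_iff (fpos _)] at e1 e2 e3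
  have hchoose (p q : ℕ) : ((p + q).choose q : ℚ) =
      (p + q).factorial / (p.factorial * q.factorial) := by
    rw [← Nat.choose_symm_add, Nat.cast_add_choose]
  rw [e1, e2, e3, show k + 1 + m + (a + b) = k + 1 + (a + b) + m by ring, hchoose, hchoose,
    hchoose, show k + 1 + a = (k + a) + 1 by ring, Nat.factorial_succ, add_comm b m]
  push_cast
  field_simp [fpos]
  ring

/-- for `d_min = (0, 1, …, i−1, i+a, i+r+1, …, N+r)` we have
`β_i(π_{d_min}) ≥ binom(N,i) · N^(−r)`. -/
theorem betti_dmin_ge (N r a i : ℕ) (hN : 1 ≤ N) (hi1 : 1 ≤ i) (hiN : i ≤ N) (ha : a ≤ r) :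
    (N.choose i : ℚ) * (N : ℚ) ^ (-(r : ℤ)) ≤
      pureBetti N (fun j => if j < i then (j : ℤ) else if j = i then (i : ℤ) + a
        else (j : ℤ) + r) i := by
  obtain ⟨k, rfl⟩ := Nat.exists_eq_add_of_le' hi1
  obtain ⟨m, rfl⟩ := Nat.exists_eq_add_of_le hiN
  obtain ⟨b, rfl⟩ := Nat.exists_eq_add_of_le ha
  rw [pureBetti_dmin_eq, zpow_neg, zpow_natCast, ← div_eq_mul_inv, Nat.choose_symm_add]
  have hpos : 0 < (k + a).choose a * (m + b).choose b :=
    Nat.mul_pos (Nat.choose_pos (by omega)) (Nat.choose_pos (by omega))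
  have hle : (k + a).choose a * (m + b).choose b ≤ (k + 1 + m) ^ (a + b) := by
    rw [pow_add]
    exact Nat.mul_le_mul
      ((Nat.choose_add_right_le_pow k a).trans (Nat.pow_le_pow_left (by omega) a))
      ((Nat.choose_add_right_le_pow m b).trans (Nat.pow_le_pow_left (by omega) b))
  have hchoose : (k + 1 + m).choose m ≤ (k + 1 + m + (a + b)).choose m :=
    Nat.choose_le_choose m (by omega)
  exact div_le_div₀ (by positivity) (by exact_mod_cast hchoose) (by exact_mod_cast hpos)
    (by exact_mod_cast hle)
end
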